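/- Expected log-eigenvalue equals minus the entropy: For k = 1,…,m let τ_k := ∑_{i∈I} γ_i σ_k(i), with spectral decomposition τ_k = ∑_{p=1}^d λ_{k,p} π_{k,p} (orthonormal eigenbasis, π_{k,p} rank-one). Set λ_k(i,i';p) := Tr(π_{k,p} σ_k(i,i')) and define the probability distribution P on {1,…,d}^m by P((p_1,…,p_m)) := ∑_{i_1,…,i_{m+1}∈I} γ_{i_1} ∏_{k=1}^m λ_k(i_k,i_{k+1};p_k). Then, assuming conditions (i) and (ii): every sequence (p) with P((p)) > 0 satisfies λ_{k,p_k} > 0 for all k, and for each fixed k, ∑_{(p) : P((p))>0} P((p)) · (−log₂ λ_{k,p_k}) = S(τ_k). -/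

import Mathlib

open scoped BigOperators ComplexOrder Matrix

/-- The rank-one projection `|v⟩⟨v|` onto a (unit) vector `v ∈ ℂ^d`. -/
noncomputable def outerProj {d : ℕ} (v : Fin d → ℂ) : Matrix (Fin d) (Fin d) ℂ :=
  Matrix.vecMulVec v (star v)

/-- The tensor product `A₁ ⊗ ⋯ ⊗ A_m` of `d × d` matrices, as a matrix on
`(ℂ^d)^{⊗m} ≃ ℂ^(Fin m → Fin d)`. -/
noncomputable def matTensor {m d : ℕ} (A : Fin m → Matrix (Fin d) (Fin d) ℂ) :
    Matrix (Fin m → Fin d) (Fin m → Fin d) ℂ :=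
  Matrix.of fun x y => ∏ k, A k (x k) (y k)

/-- The Markov-correlated state
`σ^{(m)} = ∑_{i₁,…,i_{m+1}} γ_{i₁} σ₁(i₁,i₂) ⊗ ⋯ ⊗ σ_m(i_m,i_{m+1})`. -/
noncomputable def sigmaChain {I : Type*} [Fintype I] {d m : ℕ} (γ : I → ℝ)
    (σ : Fin m → I → I → Matrix (Fin d) (Fin d) ℂ) :
    Matrix (Fin m → Fin d) (Fin m → Fin d) ℂ :=
  ∑ i : Fin (m + 1) → I,
    ((γ (i 0) : ℂ)) • matTensor (fun k => σ k (i k.castSucc) (i k.succ))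

/-- The measurement distribution
`P((p₁,…,p_m)) = ∑_{i₁,…,i_{m+1}} γ_{i₁} ∏ₖ λₖ(iₖ,i_{k+1}; pₖ)` with
`λₖ(i,i';p) = Tr(π_{k,p} σₖ(i,i'))`. -/
noncomputable def measP {I : Type*} [Fintype I] {d m : ℕ} (γ : I → ℝ)
    (σ : Fin m → I → I → Matrix (Fin d) (Fin d) ℂ)
    (π : Fin m → Fin d → Matrix (Fin d) (Fin d) ℂ) (p : Fin m → Fin d) : ℝ :=
  ∑ i : Fin (m + 1) → I,
    γ (i 0) * ∏ k, (Matrix.trace (π k (p k) * σ k (i k.castSucc) (i k.succ))).re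

/-- The Shannon entropy (base 2) of an eigenvalue list. -/
noncomputable def shannonEntropy {d : ℕ} (lam : Fin d → ℝ) : ℝ :=
  -∑ p, lam p * Real.logb 2 (lam p)


theorem chain_total {I : Type*} [Fintype I] {m : ℕ} (γ : I → ℝ) (M : Fin m → I → I → ℝ)
    (h1 : ∀ j i, ∑ i', M j i i' = 1) :
    ∑ i : Fin (m + 1) → I, γ (i 0) * ∏ k, M k (i k.castSucc) (i k.succ) = ∑ i, γ i := by
  induction m generalizing γ with
  | zero =>
    simp only [Finset.univ_eq_empty, Finset.prod_empty, mul_one]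
    exact Fintype.sum_equiv (Equiv.funUnique (Fin 1) I) _ _ (fun x => rfl)
  | succ m ih =>
    rw [← (Fin.consEquiv (fun _ => I)).sum_comp, Fintype.sum_prod_type, Finset.sum_comm]
    have := ih (fun i' => ∑ i, γ i * M 0 i i') (fun j => M j.succ) (fun j => h1 j.succ)
    rw [Finset.sum_comm] at this
    simp only [← Finset.mul_sum, h1, mul_one] at this
    rw [← this]
    refine Finset.sum_congr rfl fun x _ => ?_
    rw [Finset.sum_mul]
    refine Finset.sum_congr rfl fun a _ => ?_
    rw [Fin.prod_univ_succ]
    simp [Fin.consEquiv, mul_assoc]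

theorem chain_marginal {I : Type*} [Fintype I] {m : ℕ} (γ : I → ℝ) (M : Fin m → I → I → ℝ)
    (k : Fin m) (h1 : ∀ j, j ≠ k → ∀ i, ∑ i', M j i i' = 1)
    (h2 : ∀ j, j ≠ k → ∀ i', ∑ i, γ i * M j i i' = γ i') :
    ∑ i : Fin (m + 1) → I, γ (i 0) * ∏ k, M k (i k.castSucc) (i k.succ) =
      ∑ i, ∑ i', γ i * M k i i' := by
  induction m with
  | zero => exact k.elim0
  | succ m ih =>
    have key : ∑ i : Fin (m + 1 + 1) → I, γ (i 0) * ∏ k, M k (i k.castSucc) (i k.succ) =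
        ∑ x : Fin (m + 1) → I, (fun i' => ∑ i, γ i * M 0 i i') (x 0) *
          ∏ k : Fin m, (fun j : Fin m => M j.succ) k (x k.castSucc) (x k.succ) := by
      rw [← (Fin.consEquiv (fun _ => I)).sum_comp, Fintype.sum_prod_type, Finset.sum_comm]
      refine Finset.sum_congr rfl fun x _ => ?_
      rw [Finset.sum_mul]
      refine Finset.sum_congr rfl fun a _ => ?_
      rw [Fin.prod_univ_succ]
      simp [Fin.consEquiv, mul_assoc]
    rw [key]
    rcases Fin.eq_zero_or_eq_succ k with rfl | ⟨k', rfl⟩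
    · refine (chain_total (fun i' => ∑ i, γ i * M 0 i i') (fun j : Fin m => M j.succ)
        (fun j => h1 j.succ (Fin.succ_ne_zero j))).trans ?_
      rw [Finset.sum_comm]
    · have h0 : (fun i' => ∑ i, γ i * M 0 i i') = γ :=
        funext (h2 0 (Fin.succ_ne_zero k').symm)
      rw [h0]
      exact ih (fun j => M j.succ) k'
        (fun j hj => h1 j.succ (fun h => hj (Fin.succ_injective _ h)))
        (fun j hj => h2 j.succ (fun h => hj (Fin.succ_injective _ h)))

theorem trace_outerProj_mul {d : ℕ} (v : Fin d → ℂ) (A : Matrix (Fin d) (Fin d) ℂ) :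
    Matrix.trace (outerProj v * A) = star v ⬝ᵥ (A *ᵥ v) := by
  rw [outerProj, Matrix.trace_mul_comm, Matrix.mul_vecMulVec, Matrix.trace_vecMulVec,
    dotProduct_comm]

theorem sum_outerProj {d : ℕ} (e : Fin d → Fin d → ℂ)
    (horth : ∀ p q, (star (e p)) ⬝ᵥ e q = if p = q then 1 else 0) :
    ∑ p, outerProj (e p) = 1 := by
  have h : (Matrix.of fun p x => star (e p x)) * (Matrix.of fun x p => e p x) = 1 := by
    ext p q
    rw [Matrix.one_apply, ← horth p q]
    rfl
  have h' := mul_eq_one_comm.mp h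
  rw [← h']
  ext x y
  simp [Matrix.sum_apply, outerProj, Matrix.vecMulVec_apply, Matrix.mul_apply]

theorem trace_outerProj_spec {d : ℕ} (e : Fin d → Fin d → ℂ) (lam : Fin d → ℝ)
    (horth : ∀ p q, (star (e p)) ⬝ᵥ e q = if p = q then 1 else 0) (r : Fin d) :
    Matrix.trace (outerProj (e r) * ∑ p, (lam p : ℂ) • outerProj (e p)) = lam r := by
  rw [Finset.mul_sum, Matrix.trace_sum]
  have : ∀ p, Matrix.trace (outerProj (e r) * (lam p : ℂ) • outerProj (e p)) =
      if p = r then (lam p : ℂ) else 0 := by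
    intro p
    rw [Matrix.mul_smul, Matrix.trace_smul, trace_outerProj_mul, outerProj,
      Matrix.vecMulVec_mulVec, horth]
    by_cases h : p = r
    · subst h; simp [horth]
    · simp [h]
  simp only [this, Finset.sum_ite_eq', Finset.mem_univ, if_true]

theorem measP_nonneg {I : Type*} [Fintype I] {d m : ℕ}
    (γ : I → ℝ) (hγ0 : ∀ i, 0 ≤ γ i)
    (σ : Fin m → I → I → Matrix (Fin d) (Fin d) ℂ)
    (hpsd : ∀ k i i', (σ k i i').PosSemidef) (e : Fin m → Fin d → Fin d → ℂ)
    (p : Fin m → Fin d) : 0 ≤ measP γ σ (fun k r => outerProj (e k r)) p := by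
  refine Finset.sum_nonneg fun i _ => mul_nonneg (hγ0 _) (Finset.prod_nonneg fun k _ => ?_)
  rw [trace_outerProj_mul]
  exact (Complex.le_def.mp ((hpsd k _ _).dotProduct_mulVec_nonneg (e k (p k)))).1

theorem measP_marginal {I : Type*} [Fintype I] {d m : ℕ}
    (γ : I → ℝ)
    (σ : Fin m → I → I → Matrix (Fin d) (Fin d) ℂ)
    (hi : ∀ k i', ∑ i, (γ i : ℂ) * Matrix.trace (σ k i i') = (γ i' : ℂ))
    (hii : ∀ k i, Matrix.trace (∑ i', σ k i i') = 1)
    (e : Fin m → Fin d → Fin d → ℂ) (lam : Fin m → Fin d → ℝ)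
    (horth : ∀ k p q, (star (e k p)) ⬝ᵥ e k q = if p = q then 1 else 0)
    (hspec : ∀ k, ∑ i, (γ i : ℂ) • ∑ i', σ k i i' =
      ∑ p, (lam k p : ℂ) • outerProj (e k p)) (k : Fin m) (f : Fin d → ℝ) :
    ∑ p : Fin m → Fin d, measP γ σ (fun k r => outerProj (e k r)) p * f (p k) =
      ∑ r, lam k r * f r := by
  have hT : ∀ j i i', ∑ r, (Matrix.trace (outerProj (e j r) * σ j i i')).re =
      (Matrix.trace (σ j i i')).re := by
    intro j i i'
    rw [← Complex.re_sum, ← Matrix.trace_sum, ← Finset.sum_mul, sum_outerProj _ (horth j),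
      one_mul]
  have hlam : ∀ r, ∑ i, ∑ i', γ i * (Matrix.trace (outerProj (e k r) * σ k i i')).re
      = lam k r := by
    intro r
    have := congrArg Complex.re (trace_outerProj_spec (e k) (lam k) (horth k) r)
    rw [← hspec, Complex.ofReal_re] at this
    rw [← this]
    simp [Finset.mul_sum, Matrix.trace_sum, Matrix.mul_smul, Matrix.trace_smul,
      Complex.re_sum]
  let M : Fin m → I → I → ℝ := fun j i i' =>
    ∑ r, (Matrix.trace (outerProj (e j r) * σ j i i')).re * (if j = k then f r else 1)
  have hM : ∀ j, j ≠ k → ∀ i i', M j i i' = (Matrix.trace (σ j i i')).re := by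
    intro j hj i i'
    simp [M, hj, hT]
  have hc := chain_marginal γ M k
    (by
      intro j hj i
      simp only [hM j hj]
      rw [← Complex.re_sum, ← Matrix.trace_sum, hii, Complex.one_re])
    (by
      intro j hj i'
      simp only [hM j hj]
      have := congrArg Complex.re (hi j i')
      simpa [Complex.re_sum] using this)
  have hL : ∑ p : Fin m → Fin d, measP γ σ (fun k r => outerProj (e k r)) p * f (p k) =
      ∑ i : Fin (m + 1) → I, γ (i 0) * ∏ k, M k (i k.castSucc) (i k.succ) := by
    simp only [measP, Finset.sum_mul]
    rw [Finset.sum_comm]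
    refine Finset.sum_congr rfl fun i _ => ?_
    simp only [M]
    rw [Finset.prod_univ_sum, Finset.mul_sum, Fintype.piFinset_univ]
    refine Finset.sum_congr rfl fun p _ => ?_
    rw [Finset.prod_mul_distrib, mul_assoc]
    simp
  rw [hL, hc]
  simp only [← hlam, Finset.sum_mul]
  conv_rhs => rw [Finset.sum_comm]
  refine Finset.sum_congr rfl fun i _ => ?_
  conv_rhs => rw [Finset.sum_comm]
  refine Finset.sum_congr rfl fun i' _ => ?_
  simp [M, Finset.mul_sum, mul_assoc]

/-- Expected log-eigenvalue equals minus the entropy: if `τ_k = ∑ᵢ γᵢ σ_k(i)` has spectral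
decomposition `τ_k = ∑ₚ λ_{k,p} π_{k,p}`, then every sequence of positive `P`-probability
visits only positive eigenvalues, and `∑_{(p) : P((p))>0} P((p)) (−log₂ λ_{k,p_k}) = S(τ_k)`
for each `k`. -/
theorem measP_expected_log_eigenvalue {I : Type*} [Fintype I] {d m : ℕ}
    (γ : I → ℝ) (hγ0 : ∀ i, 0 ≤ γ i) (hγ1 : ∑ i, γ i = 1)
    (σ : Fin m → I → I → Matrix (Fin d) (Fin d) ℂ)
    (hpsd : ∀ k i i', (σ k i i').PosSemidef)
    (hi : ∀ k i', ∑ i, (γ i : ℂ) * Matrix.trace (σ k i i') = (γ i' : ℂ))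
    (hii : ∀ k i, Matrix.trace (∑ i', σ k i i') = 1)
    (e : Fin m → Fin d → Fin d → ℂ) (lam : Fin m → Fin d → ℝ)
    (horth : ∀ k p q, (star (e k p)) ⬝ᵥ e k q = if p = q then 1 else 0)
    (hspec : ∀ k, ∑ i, (γ i : ℂ) • ∑ i', σ k i i' =
      ∑ p, (lam k p : ℂ) • outerProj (e k p)) :
    (∀ p : Fin m → Fin d,
      0 < measP γ σ (fun k r => outerProj (e k r)) p → ∀ k, 0 < lam k (p k)) ∧
    (∀ k : Fin m,
      ∑ p ∈ Finset.univ.filter fun p : Fin m → Fin d =>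
          0 < measP γ σ (fun k' r => outerProj (e k' r)) p,
        measP γ σ (fun k' r => outerProj (e k' r)) p * (-Real.logb 2 (lam k (p k))) =
      shannonEntropy (lam k)) := by
  have hP := measP_nonneg γ hγ0 σ hpsd e
  have hm := measP_marginal γ σ hi hii e lam horth hspec
  refine ⟨fun p hp k => ?_, fun k => ?_⟩
  · have h := hm k (fun r => if r = p k then 1 else 0)
    simp only [mul_ite, mul_one, mul_zero, Finset.sum_ite_eq', Finset.mem_univ, if_true] at h
    rw [← h]
    refine lt_of_lt_of_le hp ?_
    refine le_trans (le_of_eq ?_) (Finset.single_le_sum (f := fun q : Fin m → Fin d =>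
      if q k = p k then measP γ σ (fun k r => outerProj (e k r)) q else 0)
      (fun q _ => ?_) (Finset.mem_univ p))
    · simp
    · split_ifs
      · exact hP q
      · exact le_rfl
  · have h := hm k (fun r => -Real.logb 2 (lam k r))
    rw [Finset.sum_filter_of_ne, h, shannonEntropy]
    · simp
    · intro p _ hne
      exact lt_of_le_of_ne (hP p) (fun h0 => hne (by rw [← h0, zero_mul]))
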